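/- (Wei's theorem) Let S(t) be a strongly continuous one-parameter semigroup of contractions (‖S(t)‖ ≤ 1 for all t ≥ 0) on a complex Hilbert space H, with generator A, and suppose r > 0 is such that the resolvent bound R(0, r) holds, i.e. for every z ∈ ℂ with Re z > 0 the operator z − A : D(A) → H is bijective and ‖z x − A x‖ ≥ r ‖x‖ for all x ∈ D(A). Then ‖S(t)‖ ≤ e^{π/2 − r t} for all t ≥ 0. -/

import Mathlib

open Set MeasureTheory

/-- A strongly continuous one-parameter semigroup on a Hilbert space. -/
structure IsC0Semigroup {H : Type*} [NormedAddCommGroup H] [InnerProductSpace ℂ H]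
    (S : ℝ → H →L[ℂ] H) : Prop where
  map_zero : S 0 = 1
  map_add : ∀ s, 0 ≤ s → ∀ t, 0 ≤ t → S (s + t) = S s ∘L S t
  cont : ∀ x : H, ContinuousOn (fun t => S t x) (Ici 0)

/-- `A : D →ₗ[ℂ] H` (with `D` a dense subspace of `H`) is the generator of the semigroup `S`. -/
structure IsGenerator {H : Type*} [NormedAddCommGroup H] [InnerProductSpace ℂ H]
    (S : ℝ → H →L[ℂ] H) (D : Submodule ℂ H) (A : D →ₗ[ℂ] H) : Prop where
  dense : Dense (D : Set H)
  mem : ∀ (x : D) (t : ℝ), 0 ≤ t → S t (x : H) ∈ D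
  hasDeriv : ∀ (x : D) (t : ℝ) (ht : 0 ≤ t),
    HasDerivWithinAt (fun s => S s (x : H)) (A ⟨S t (x : H), mem x t ht⟩) (Ici 0) t
  commutes : ∀ (x : D) (t : ℝ) (ht : 0 ≤ t),
    A ⟨S t (x : H), mem x t ht⟩ = S t (A x)

/-- The resolvent bound `R(ω, r)`: for every `z` with `Re z > ω`, `z - A : D(A) → H` is
bijective and `‖(z - A) x‖ ≥ r ‖x‖`, i.e. `‖(z - A)⁻¹‖ ≤ 1/r`. -/
def ResolventBound {H : Type*} [NormedAddCommGroup H] [InnerProductSpace ℂ H]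
    (D : Submodule ℂ H) (A : D →ₗ[ℂ] H) (ω r : ℝ) : Prop :=
  ∀ z : ℂ, ω < z.re →
    Function.Bijective (fun x : D => z • (x : H) - A x) ∧
    ∀ x : D, r * ‖(x : H)‖ ≤ ‖z • (x : H) - A x‖

open FourierTransform SchwartzMap ContDiff in
/-- On `L¹ ∩ L²` the `L²` Fourier transform is given by the Fourier integral. -/
theorem Lp_fourier_toLp_ae_eq {H : Type*} [NormedAddCommGroup H] [InnerProductSpace ℂ H]
    [CompleteSpace H] {f : ℝ → H} (hf : Integrable f) (hf2 : MemLp f 2) :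
    (𝓕 (hf2.toLp f) : Lp (α := ℝ) H 2 volume) =ᵐ[volume] (𝓕 f : ℝ → H) := by
  have hcont : Continuous (𝓕 f : ℝ → H) :=
    VectorFourier.fourierIntegral_continuous Real.continuous_fourierChar
      (innerSL ℝ).continuous₂ hf
  refine ae_eq_of_integral_contDiff_smul_eq
    ((Lp.memLp _).locallyIntegrable (by norm_num)) hcont.locallyIntegrable ?_
  intro g g_smooth g_cpt
  have hg₁ : HasCompactSupport (Complex.ofRealCLM ∘ g) := g_cpt.comp_left rfl
  have hg₂ : ContDiff ℝ ∞ (Complex.ofRealCLM ∘ g) := by fun_prop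
  set φ : 𝓢(ℝ, ℂ) := hg₁.toSchwartzMap hg₂ with hφ
  have hφa : ∀ x, φ x = (g x : ℂ) := fun x => rfl
  have h1 : ∫ x, φ x • (𝓕 (hf2.toLp f) : Lp (α := ℝ) H 2 volume) x = ∫ x, (𝓕 φ) x • (hf2.toLp f) x := by
    have := congrArg (fun T : 𝓢'(ℝ, H) => T φ)
      (Lp.fourier_toTemperedDistribution_eq (hf2.toLp f))
    simpa using this.symm
  have h2 : ∫ x, (𝓕 φ) x • (hf2.toLp f) x = ∫ x, (𝓕 φ) x • f x := by
    refine integral_congr_ae ?_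
    filter_upwards [hf2.coeFn_toLp] with x hx
    rw [hx]
  have h3 : ∫ x, (𝓕 φ) x • f x = ∫ x, φ x • (𝓕 f : ℝ → H) x := by
    have := VectorFourier.integral_fourierIntegral_smul_eq_flip (L := innerₗ ℝ)
      (μ := volume) (ν := volume) Real.continuous_fourierChar continuous_inner
      φ.integrable hf
    rw [flip_innerₗ] at this
    rw [SchwartzMap.fourier_coe]
    exact this
  simpa [hφa] using h1.trans (h2.trans h3)

theorem MeasureTheory.MemLp.norm_toLp_two_sq {E : Type*} [NormedAddCommGroup E] {f : ℝ → E}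
    (hf : MemLp f 2) : ‖hf.toLp f‖ ^ 2 = ∫ s, ‖f s‖ ^ 2 := by
  rw [Lp.norm_toLp, hf.eLpNorm_eq_integral_rpow_norm (by norm_num) (by norm_num),
    ENNReal.toReal_ofReal (by positivity)]
  have h0 : 0 ≤ ∫ s, ‖f s‖ ^ 2 := integral_nonneg fun _ => by positivity
  simp only [ENNReal.toReal_ofNat, Real.rpow_ofNat]
  rw [← Real.rpow_natCast, ← Real.rpow_mul h0]
  norm_num

open FourierTransform in
/-- Plancherel: a pointwise bound between Fourier integrals gives the same bound in `L²`. -/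
theorem integral_norm_sq_le_of_fourier_le {H : Type*} [NormedAddCommGroup H]
    [InnerProductSpace ℂ H] [CompleteSpace H] {f g : ℝ → H} (hf : Integrable f)
    (hf2 : MemLp f 2) (hg : Integrable g) (hg2 : MemLp g 2) {r : ℝ} (hr : 0 < r)
    (h : ∀ ξ, r * ‖(𝓕 f : ℝ → H) ξ‖ ≤ ‖(𝓕 g : ℝ → H) ξ‖) :
    r ^ 2 * ∫ s, ‖f s‖ ^ 2 ≤ ∫ s, ‖g s‖ ^ 2 := by
  have key : ‖(𝓕 (hf2.toLp f) : Lp (α := ℝ) H 2 volume)‖ ≤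
      r⁻¹ * ‖(𝓕 (hg2.toLp g) : Lp (α := ℝ) H 2 volume)‖ := by
    refine Lp.norm_le_mul_norm_of_ae_le_mul ?_
    filter_upwards [Lp_fourier_toLp_ae_eq hf hf2, Lp_fourier_toLp_ae_eq hg hg2] with ξ h1 h2
    rw [h1, h2, inv_mul_eq_div, le_div_iff₀' hr]
    exact h ξ
  rw [Lp.norm_fourier_eq, Lp.norm_fourier_eq, inv_mul_eq_div, le_div_iff₀' hr] at key
  rw [← hf2.norm_toLp_two_sq, ← hg2.norm_toLp_two_sq, ← mul_pow]
  exact pow_le_pow_left₀ (by positivity) key 2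

/-- Bounded left inverse of `z - A` furnished by the resolvent bound. -/
theorem ResolventBound.exists_resolvent {H : Type*} [NormedAddCommGroup H]
    [InnerProductSpace ℂ H] {D : Submodule ℂ H} {A : D →ₗ[ℂ] H} {r : ℝ} (hr : 0 < r)
    (hres : ResolventBound D A 0 r) {z : ℂ} (hz : 0 < z.re) :
    ∃ R : H →L[ℂ] H, (∀ y : D, R (z • (y : H) - A y) = y) ∧ ∀ y, r * ‖R y‖ ≤ ‖y‖ := by
  obtain ⟨hbij, hbd⟩ := hres z hz
  let e : D ≃ₗ[ℂ] H := LinearEquiv.ofBijective (z • D.subtype - A) hbij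
  have he : ∀ y : D, e y = z • (y : H) - A y := fun y => rfl
  have hR : ∀ y, r * ‖((e.symm y : D) : H)‖ ≤ ‖y‖ := fun y => by
    have := hbd (e.symm y)
    rwa [← he, e.apply_symm_apply] at this
  refine ⟨(D.subtype ∘ₗ e.symm.toLinearMap).mkContinuous r⁻¹ fun y => ?_, fun y => ?_, hR⟩
  · rw [inv_mul_eq_div, le_div_iff₀' hr]
    exact hR y
  · change ((e.symm (z • (y : H) - A y) : D) : H) = y
    rw [← he, e.symm_apply_apply]

/-- Laplace-side comparison of `χ(s) S(s) x` with `(∂ₛ - A) (χ(s) S(s) x) = χ'(s) S(s) x`. -/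
theorem norm_integral_exp_smul_le {H : Type*} [NormedAddCommGroup H] [InnerProductSpace ℂ H]
    [CompleteSpace H] {S : ℝ → H →L[ℂ] H} {D : Submodule ℂ H} {A : D →ₗ[ℂ] H}
    (hS : IsC0Semigroup S) (hA : IsGenerator S D A) {r : ℝ} (hr : 0 < r)
    (hres : ResolventBound D A 0 r) {χ χ' : ℝ → ℝ} (hχ : ∀ s, HasDerivAt χ (χ' s) s)
    (hχ' : Continuous χ') {P : ℝ} (hP : 0 ≤ P) (h0 : χ 0 = 0) (h1 : χ P = 0) (x : D)
    {z : ℂ} (hz : 0 < z.re) :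
    r * ‖∫ s in (0)..P, (Complex.exp (-z * s) * χ s) • S s (x : H)‖ ≤
      ‖∫ s in (0)..P, (Complex.exp (-z * s) * χ' s) • S s (x : H)‖ := by
  obtain ⟨R, hR, hRb⟩ := hres.exists_resolvent hr hz
  have hχc : Continuous χ := continuous_iff_continuousAt.2 fun s => (hχ s).continuousAt
  have hY : ∀ y : H, ContinuousOn (fun s => S s y) (Icc 0 P) := fun y =>
    (hS.cont y).mono Icc_subset_Ici_self
  have hc1 : Continuous fun s : ℝ => Complex.exp (-z * s) * χ s := by fun_prop
  have hc2 : Continuous fun s : ℝ => Complex.exp (-z * s) * χ' s := by fun_prop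
  have hi1 : IntervalIntegrable (fun s : ℝ => (Complex.exp (-z * s) * χ' s) • S s (x : H))
      volume 0 P :=
    ContinuousOn.intervalIntegrable_of_Icc hP (hc2.continuousOn.smul (hY _))
  have hi2 : IntervalIntegrable
      (fun s : ℝ => (Complex.exp (-z * s) * χ s) • (z • S s (x : H) - S s (A x))) volume 0 P :=
    ContinuousOn.intervalIntegrable_of_Icc hP
      (hc1.continuousOn.smul (((hY _).const_smul z).sub (hY _)))
  have hftc := intervalIntegral.integral_eq_sub_of_hasDerivAt_of_le hP
    (f := fun s : ℝ => (Complex.exp (-z * s) * χ s) • S s (x : H))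
    (f' := fun s : ℝ => (Complex.exp (-z * s) * χ' s) • S s (x : H) -
      (Complex.exp (-z * s) * χ s) • (z • S s (x : H) - S s (A x)))
    (hc1.continuousOn.smul (hY _)) (fun s hs => by
      have hd1 : HasDerivAt (fun s : ℝ => S s (x : H)) (S s (A x)) s := by
        have := (hA.hasDeriv x s hs.1.le).hasDerivAt (Ici_mem_nhds hs.1)
        rwa [hA.commutes x s hs.1.le] at this
      have hd2 : HasDerivAt (fun s : ℝ => Complex.exp (-z * s))
          (Complex.exp (-z * s) * (-z * 1)) s :=
        ((Complex.ofRealCLM.hasDerivAt (x := s)).const_mul (-z)).cexp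
      have hd3 := (hd2.mul (hχ s).ofReal_comp).smul hd1
      refine hd3.congr_deriv ?_
      simp only [Pi.mul_apply]
      module) (hi1.sub hi2)
  rw [intervalIntegral.integral_sub hi1 hi2, h0, h1] at hftc
  simp only [Complex.ofReal_zero, mul_zero, zero_smul, sub_zero, sub_eq_zero] at hftc
  have hfin : R (∫ s in (0)..P, (Complex.exp (-z * s) * χ' s) • S s (x : H)) =
      ∫ s in (0)..P, (Complex.exp (-z * s) * χ s) • S s (x : H) := by
    rw [hftc, ← R.intervalIntegral_comp_comm hi2]
    refine intervalIntegral.integral_congr fun s hs => ?_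
    rw [uIcc_of_le hP] at hs
    have := hR ⟨S s (x : H), hA.mem x s hs.1⟩
    rw [hA.commutes x s hs.1] at this
    simp only [map_smul, this]
  rw [← hfin]
  exact hRb _

/-- The time-domain form of the resolvent bound, for cut-off trajectories. -/
theorem integral_cutoff_le {H : Type*} [NormedAddCommGroup H] [InnerProductSpace ℂ H]
    [CompleteSpace H] {S : ℝ → H →L[ℂ] H} {D : Submodule ℂ H} {A : D →ₗ[ℂ] H}
    (hS : IsC0Semigroup S) (hA : IsGenerator S D A) {r : ℝ} (hr : 0 < r)
    (hres : ResolventBound D A 0 r) {χ χ' : ℝ → ℝ} (hχ : ∀ s, HasDerivAt χ (χ' s) s)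
    (hχ' : Continuous χ') {P : ℝ} (hP : 0 ≤ P) (h0 : χ 0 = 0) (h1 : χ P = 0) (x : D) :
    r ^ 2 * ∫ s in (0)..P, χ s ^ 2 * ‖S s (x : H)‖ ^ 2 ≤
      ∫ s in (0)..P, χ' s ^ 2 * ‖S s (x : H)‖ ^ 2 := by
  have hχc : Continuous χ := continuous_iff_continuousAt.2 fun s => (hχ s).continuousAt
  have hY : ContinuousOn (fun s => S s (x : H)) (Icc 0 P) :=
    (hS.cont x).mono Icc_subset_Ici_self
  let F : ℝ → (ℝ → ℝ) → ℝ → H := fun ε φ =>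
    (Ioc 0 P).indicator fun s => ((Real.exp (-ε * s) * φ s : ℝ) : ℂ) • S s (x : H)
  have hFc : ∀ ε φ, Continuous φ →
      ContinuousOn (fun s => ((Real.exp (-ε * s) * φ s : ℝ) : ℂ) • S s (x : H)) (Icc 0 P) :=
    fun ε φ hφ => (by fun_prop : Continuous fun s : ℝ =>
      ((Real.exp (-ε * s) * φ s : ℝ) : ℂ)).continuousOn.smul hY
  have hFi : ∀ ε φ, Continuous φ → Integrable (F ε φ) := fun ε φ hφ =>
    ((hFc ε φ hφ).integrableOn_Icc.mono_set Ioc_subset_Icc_self).integrable_indicator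
      measurableSet_Ioc
  have hF2 : ∀ ε φ, Continuous φ → MemLp (F ε φ) 2 := fun ε φ hφ => by
    obtain ⟨C, hC⟩ := isCompact_Icc.exists_bound_of_continuousOn (hFc ε φ hφ)
    refine (memLp_indicator_iff_restrict measurableSet_Ioc).2 ?_
    refine MemLp.of_bound
      ((hFi ε φ hφ).aestronglyMeasurable.restrict.congr ?_) C ?_
    · exact indicator_ae_eq_restrict measurableSet_Ioc
    · exact (ae_restrict_mem measurableSet_Ioc).mono fun s hs => hC s ⟨hs.1.le, hs.2⟩
  have hFF : ∀ ε φ (ξ : ℝ), (FourierTransform.fourier (F ε φ) : ℝ → H) ξ =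
      ∫ s in (0)..P, (Complex.exp (-(ε + 2 * Real.pi * ξ * Complex.I) * s) * φ s) •
        S s (x : H) := by
    intro ε φ ξ
    rw [Real.fourier_real_eq_integral_exp_smul, intervalIntegral.integral_of_le hP,
      ← integral_indicator measurableSet_Ioc]
    refine integral_congr_ae (Filter.Eventually.of_forall fun s => ?_)
    by_cases hs : s ∈ Ioc 0 P
    · simp only [F, indicator_of_mem hs, smul_smul]
      congr 1
      push_cast
      rw [← mul_assoc, ← Complex.exp_add]
      congr 2
      ring
    · simp [F, indicator_of_notMem hs]
  have hFn : ∀ ε φ, ∫ s, ‖F ε φ s‖ ^ 2 =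
      ∫ s in (0)..P, Real.exp (-ε * s) ^ 2 * (φ s ^ 2 * ‖S s (x : H)‖ ^ 2) := by
    intro ε φ
    rw [intervalIntegral.integral_of_le hP, ← integral_indicator measurableSet_Ioc]
    refine integral_congr_ae (Filter.Eventually.of_forall fun s => ?_)
    by_cases hs : s ∈ Ioc 0 P
    · simp only [F, indicator_of_mem hs, norm_smul, Complex.norm_real, mul_pow, norm_mul,
        Real.norm_eq_abs, sq_abs]
      ring
    · simp [F, indicator_of_notMem hs]
  have hint : ∀ ε φ, Continuous φ → IntervalIntegrable
      (fun s => Real.exp (-ε * s) ^ 2 * (φ s ^ 2 * ‖S s (x : H)‖ ^ 2)) volume 0 P :=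
    fun ε φ hφ => ContinuousOn.intervalIntegrable_of_Icc hP
      ((by fun_prop : Continuous fun s => Real.exp (-ε * s) ^ 2).continuousOn.mul
        ((hφ.pow 2).continuousOn.mul (hY.norm.pow 2)))
  have hint0 : ∀ φ, Continuous φ → IntervalIntegrable
      (fun s => φ s ^ 2 * ‖S s (x : H)‖ ^ 2) volume 0 P := fun φ hφ => by
    simpa using hint 0 φ hφ
  have key : ∀ ε, 0 < ε →
      r ^ 2 * (Real.exp (-ε * P) ^ 2 * ∫ s in (0)..P, χ s ^ 2 * ‖S s (x : H)‖ ^ 2) ≤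
      ∫ s in (0)..P, χ' s ^ 2 * ‖S s (x : H)‖ ^ 2 := by
    intro ε hε
    have h := integral_norm_sq_le_of_fourier_le (hFi ε χ hχc) (hF2 ε χ hχc) (hFi ε χ' hχ')
      (hF2 ε χ' hχ') hr fun ξ => by
        rw [hFF, hFF]
        exact norm_integral_exp_smul_le hS hA hr hres hχ hχ' hP h0 h1 x (by simp [hε])
    rw [hFn, hFn] at h
    refine le_trans ?_ (h.trans ?_)
    · rw [← intervalIntegral.integral_const_mul]
      refine mul_le_mul_of_nonneg_left ?_ (by positivity)
      refine intervalIntegral.integral_mono_on hP ((hint0 χ hχc).const_mul _) (hint ε χ hχc)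
        fun s hs => ?_
      have : Real.exp (-ε * P) ≤ Real.exp (-ε * s) :=
        Real.exp_le_exp.2 (by nlinarith [hs.2])
      gcongr
    · refine intervalIntegral.integral_mono_on hP (hint ε χ' hχ') (hint0 χ' hχ') fun s hs => ?_
      have : Real.exp (-ε * s) ≤ 1 := Real.exp_le_one_iff.2 (by nlinarith [hs.1])
      exact mul_le_of_le_one_left (by positivity) (pow_le_one₀ (by positivity) this)
  have hlim : Filter.Tendsto (fun ε : ℝ => r ^ 2 * (Real.exp (-ε * P) ^ 2 *
      ∫ s in (0)..P, χ s ^ 2 * ‖S s (x : H)‖ ^ 2)) (nhdsWithin 0 (Ioi 0))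
      (nhds (r ^ 2 * (Real.exp (-0 * P) ^ 2 *
        ∫ s in (0)..P, χ s ^ 2 * ‖S s (x : H)‖ ^ 2))) :=
    (Continuous.tendsto (by fun_prop) 0).mono_left nhdsWithin_le_nhds
  simpa using le_of_tendsto hlim (eventually_mem_nhdsWithin.mono key)

/-- Two functions gluing to first order at `a` glue to a differentiable function. -/
theorem hasDerivAt_ite_le {f g f' g' : ℝ → ℝ} {a : ℝ} (hf : ∀ s, HasDerivAt f (f' s) s)
    (hg : ∀ s, HasDerivAt g (g' s) s) (h : f a = g a) (h' : f' a = g' a) (s : ℝ) :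
    HasDerivAt (fun s => if s ≤ a then f s else g s) (if s ≤ a then f' s else g' s) s := by
  rcases lt_trichotomy s a with hs | rfl | hs
  · rw [if_pos hs.le]
    exact (hf s).congr_of_eventuallyEq
      ((eventually_lt_nhds hs).mono fun u hu => if_pos hu.le)
  · rw [if_pos le_rfl, ← hasDerivWithinAt_univ, ← Iic_union_Ici (a := s)]
    refine HasDerivWithinAt.union ?_ ?_
    · exact (hf s).hasDerivWithinAt.congr (fun u hu => if_pos hu) (if_pos le_rfl)
    · rw [h']
      refine (hg s).hasDerivWithinAt.congr (fun u hu => ?_) ((if_pos le_rfl).trans h)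
      rcases (mem_Ici.1 hu).eq_or_lt with rfl | hu
      · exact (if_pos le_rfl).trans h
      · exact if_neg hu.not_ge
  · rw [if_neg hs.not_ge]
    exact (hg s).congr_of_eventuallyEq
      ((eventually_gt_nhds hs).mono fun u hu => if_neg hu.not_ge)

theorem integral_cos_mul_sub {r : ℝ} (hr : r ≠ 0) (T u v : ℝ) :
    ∫ s in u..v, Real.cos (2 * (r * (s - T))) =
      (Real.sin (2 * (r * (v - T))) - Real.sin (2 * (r * (u - T)))) / (2 * r) := by
  rw [intervalIntegral.integral_eq_sub_of_hasDerivAt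
    (f := fun s => Real.sin (2 * (r * (s - T))) / (2 * r)) (fun s _ => ?_)
    ((by fun_prop : Continuous fun s => Real.cos (2 * (r * (s - T)))).intervalIntegrable _ _)]
  · ring
  · have := ((((hasDerivAt_id s).sub_const T).const_mul r).const_mul 2).sin.div_const (2 * r)
    refine this.congr_deriv ?_
    simp only [id]
    field_simp

/-- Decay of a nonincreasing weight `h` which satisfies the cut-off inequality. -/
theorem AntitoneOn.le_exp_of_cutoff {h : ℝ → ℝ} (hh : AntitoneOn h (Ici 0))
    (hc : ContinuousOn h (Ici 0)) {r T : ℝ} (hr : 0 < r) (hT : Real.pi / 2 ≤ r * T)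
    (hcut : ∀ (χ χ' : ℝ → ℝ) (P : ℝ), (∀ s, HasDerivAt χ (χ' s) s) → Continuous χ' → 0 ≤ P →
      χ 0 = 0 → χ P = 0 →
      r ^ 2 * ∫ s in (0)..P, χ s ^ 2 * h s ≤ ∫ s in (0)..P, χ' s ^ 2 * h s) :
    h T ≤ Real.exp (Real.pi - 2 * (r * T)) * h 0 := by
  have hpi := Real.pi_pos
  obtain ⟨a, ha⟩ : ∃ a, a = Real.pi / (4 * r) := ⟨_, rfl⟩
  have hra : r * a = Real.pi / 4 := by rw [ha]; field_simp
  have ha0 : 0 < a := by rw [ha]; positivity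
  have haT : 2 * a ≤ T := by
    refine le_of_mul_le_mul_left (a := r) ?_ hr
    linarith
  obtain ⟨M, hM⟩ : ∃ M, M = Real.exp (r * (T - a - a)) := ⟨_, rfl⟩
  obtain ⟨c, hcd⟩ : ∃ c, c = √2 / 2 := ⟨_, rfl⟩
  have hsin : Real.sin (r * a) = c := by rw [hra, Real.sin_pi_div_four, hcd]
  have hcos : Real.cos (r * a) = c := by rw [hra, Real.cos_pi_div_four, hcd]
  have hTa : r * (T - a - T) = -(r * a) := by ring
  set χ₂ : ℝ → ℝ := fun s => if s ≤ T - a then c * Real.exp (r * (s - a)) else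
    M * Real.cos (r * (s - T)) with hχ₂
  set χ₂' : ℝ → ℝ := fun s => if s ≤ T - a then r * (c * Real.exp (r * (s - a))) else
    -(r * (M * Real.sin (r * (s - T)))) with hχ₂'
  set χ : ℝ → ℝ := fun s => if s ≤ a then Real.sin (r * s) else χ₂ s with hχ
  set χ' : ℝ → ℝ := fun s => if s ≤ a then r * Real.cos (r * s) else χ₂' s with hχ'
  have hd₂ : ∀ s, HasDerivAt χ₂ (χ₂' s) s := by
    refine hasDerivAt_ite_le (f' := fun s => r * (c * Real.exp (r * (s - a))))
      (g' := fun s => -(r * (M * Real.sin (r * (s - T))))) (fun s => ?_) (fun s => ?_) ?_ ?_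
    · refine ((((hasDerivAt_id s).sub_const a).const_mul r).exp.const_mul c).congr_deriv ?_
      simp only [id]
      ring
    · refine ((((hasDerivAt_id s).sub_const T).const_mul r).cos.const_mul M).congr_deriv ?_
      simp only [id]
      ring
    · rw [hTa, Real.cos_neg, hcos, ← hM, mul_comm]
    · rw [hTa, Real.sin_neg, hsin, ← hM]
      ring
  have hd : ∀ s, HasDerivAt χ (χ' s) s := by
    refine hasDerivAt_ite_le (f' := fun s => r * Real.cos (r * s)) (fun s => ?_) hd₂ ?_ ?_
    · refine ((hasDerivAt_id s).const_mul r).sin.congr_deriv ?_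
      simp only [id]
      ring
    · rw [hχ₂]
      simp only
      rw [if_pos (by linarith), hsin]
      simp
    · rw [hχ₂']
      simp only
      rw [if_pos (by linarith), hcos]
      simp
  have hχc : Continuous χ := continuous_iff_continuousAt.2 fun s => (hd s).continuousAt
  have hχ₂c' : Continuous χ₂' := by
    refine Continuous.if_le (by fun_prop) (by fun_prop) continuous_id continuous_const ?_
    rintro s rfl
    rw [hTa, Real.sin_neg, hsin, ← hM]
    ring
  have hχc' : Continuous χ' := by
    refine Continuous.if_le (by fun_prop) hχ₂c' continuous_id continuous_const ?_
    rintro s rfl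
    rw [hχ₂']
    simp only
    rw [if_pos (by linarith), hcos]
    simp
  set φ : ℝ → ℝ := fun s => r ^ 2 * χ s ^ 2 - χ' s ^ 2 with hφ
  have hφc : Continuous φ := by fun_prop
  have hφ1 : ∀ s ≤ a, φ s = -r ^ 2 * Real.cos (2 * (r * (s - 0))) := fun s hs => by
    simp only [hφ, hχ, hχ', if_pos hs, sub_zero, Real.cos_two_mul']
    ring
  have hφ2 : ∀ s, a < s → s ≤ T - a → φ s = 0 := fun s hs hs' => by
    simp only [hφ, hχ, hχ', hχ₂, hχ₂', if_neg hs.not_ge, if_pos hs']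
    ring
  have hφ3 : ∀ s, T - a < s → φ s = r ^ 2 * M ^ 2 * Real.cos (2 * (r * (s - T))) :=
    fun s hs => by
      have hs' : ¬ s ≤ a := by linarith
      simp only [hφ, hχ, hχ', hχ₂, hχ₂', if_neg hs', if_neg hs.not_ge, Real.cos_two_mul']
      ring
  have hi : ∀ ψ : ℝ → ℝ, Continuous ψ → ∀ u v, 0 ≤ u → u ≤ v →
      IntervalIntegrable (fun s => ψ s * h s) volume u v := fun ψ hψ u v hu huv =>
    ContinuousOn.intervalIntegrable_of_Icc huv (hψ.continuousOn.mul
      (hc.mono fun s hs => mem_Ici.2 (hu.trans hs.1)))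
  have hlow : ∀ u v k C S, 0 ≤ u → u ≤ v → (∀ s ∈ Ioo u v,
      C * Real.cos (2 * (r * (s - S))) * k ≤ φ s * h s) →
      C * ((Real.sin (2 * (r * (v - S))) - Real.sin (2 * (r * (u - S)))) / (2 * r)) * k ≤
        ∫ s in u..v, φ s * h s := by
    intro u v k C S hu huv hle
    rw [← integral_cos_mul_sub hr.ne', ← intervalIntegral.integral_const_mul,
      ← intervalIntegral.integral_mul_const]
    exact intervalIntegral.integral_mono_on_of_le_Ioo huv
      ((by fun_prop : Continuous fun s =>
        C * Real.cos (2 * (r * (s - S))) * k).intervalIntegrable _ _)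
      (hi φ hφc u v hu huv) hle
  have hanti : ∀ s t, 0 ≤ s → s ≤ t → h t ≤ h s := fun s t hs hst =>
    hh (mem_Ici.2 hs) (mem_Ici.2 (hs.trans hst)) hst
  have hJ : ∫ s in (0)..(T + 2 * a), φ s * h s ≤ 0 := by
    have hP : 0 ≤ T + 2 * a := by linarith
    have hP' : ¬ T + 2 * a ≤ a := by linarith
    have hP'' : ¬ T + 2 * a ≤ T - a := by linarith
    have h1 := hcut χ χ' (T + 2 * a) hd hχc' hP (by simp [hχ, ha0.le]) (by
      simp only [hχ, hχ₂, if_neg hP', if_neg hP'']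
      rw [show r * (T + 2 * a - T) = Real.pi / 2 by linear_combination 2 * hra]
      simp)
    rw [← intervalIntegral.integral_const_mul, ← sub_nonpos,
      ← intervalIntegral.integral_sub ((hi (fun s => χ s ^ 2) (hχc.pow 2) 0 _ le_rfl hP).const_mul _)
        (hi (fun s => χ' s ^ 2) (hχc'.pow 2) 0 _ le_rfl hP)] at h1
    refine le_of_eq_of_le (intervalIntegral.integral_congr fun s _ => ?_) h1
    simp only [hφ]
    ring
  have e1 := hlow 0 a (h 0) (-r ^ 2) 0 le_rfl ha0.le fun s hs => by
    rw [hφ1 s hs.2.le]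
    have : r * s ≤ r * a := by gcongr; exact hs.2.le
    have h0s : 0 < r * s := mul_pos hr hs.1
    have hcs : 0 ≤ Real.cos (2 * (r * (s - 0))) :=
      Real.cos_nonneg_of_neg_pi_div_two_le_of_le (by rw [sub_zero]; linarith)
        (by rw [sub_zero]; linarith)
    have := hanti 0 s le_rfl hs.1.le
    nlinarith [mul_le_mul_of_nonneg_left this (mul_nonneg (sq_nonneg r) hcs)]
  have e2 := hlow a (T - a) 0 0 0 ha0.le (by linarith) fun s hs => by
    rw [hφ2 s hs.1 hs.2.le]
    simp
  have e3 := hlow (T - a) T (h T) (r ^ 2 * M ^ 2) T (by linarith) (by linarith) fun s hs => by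
    rw [hφ3 s hs.1]
    have h1 : r * (T - a) ≤ r * s := by gcongr; exact hs.1.le
    have h2 : r * s ≤ r * T := by gcongr; exact hs.2.le
    have hcs : 0 ≤ Real.cos (2 * (r * (s - T))) :=
      Real.cos_nonneg_of_neg_pi_div_two_le_of_le (by linarith) (by linarith)
    exact mul_le_mul_of_nonneg_left (hanti s T (by linarith [hs.1]) hs.2.le) (by positivity)
  have e4 := hlow T (T + 2 * a) (h (T + a)) (r ^ 2 * M ^ 2) T (by linarith) (by linarith)
    fun s hs => by
      rw [hφ3 s (by linarith [hs.1]), mul_assoc, mul_assoc (r ^ 2 * M ^ 2)]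
      refine mul_le_mul_of_nonneg_left ?_ (by positivity)
      rcases le_total s (T + a) with hsa | hsa
      · have h1 : r * T ≤ r * s := by gcongr; exact hs.1.le
        have h2 : r * s ≤ r * (T + a) := by gcongr
        exact mul_le_mul_of_nonneg_left (hanti s (T + a) (by linarith [hs.1]) hsa)
          (Real.cos_nonneg_of_neg_pi_div_two_le_of_le (by linarith) (by linarith))
      · have h1 : r * (T + a) ≤ r * s := by gcongr
        have h2 : r * s ≤ r * (T + 2 * a) := by gcongr; exact hs.2.le
        exact mul_le_mul_of_nonpos_left (hanti (T + a) s (by linarith) hsa)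
          (Real.cos_nonpos_of_pi_div_two_le_of_le (by linarith) (by linarith))
  have hsplit : ∫ s in (0)..(T + 2 * a), φ s * h s =
      (∫ s in (0)..a, φ s * h s) + (∫ s in a..(T - a), φ s * h s) +
      (∫ s in (T - a)..T, φ s * h s) + ∫ s in T..(T + 2 * a), φ s * h s := by
    rw [intervalIntegral.integral_add_adjacent_intervals,
      intervalIntegral.integral_add_adjacent_intervals,
      intervalIntegral.integral_add_adjacent_intervals] <;>
    exact hi φ hφc _ _ (by linarith) (by linarith)
  rw [show 2 * (r * (a - 0)) = Real.pi / 2 by linear_combination 2 * hra] at e1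
  rw [show 2 * (r * (T - a - T)) = -(Real.pi / 2) by linear_combination -2 * hra] at e3
  rw [show 2 * (r * (T + 2 * a - T)) = Real.pi by linear_combination 4 * hra] at e4
  simp only [sub_self, mul_zero, Real.sin_zero, Real.sin_neg, Real.sin_pi_div_two,
    Real.sin_pi, sub_zero, zero_div, zero_mul, sub_neg_eq_add, zero_add] at e1 e2 e3 e4
  have hsum : r ^ 2 * M ^ 2 * (1 / (2 * r)) * h T + -r ^ 2 * (1 / (2 * r)) * h 0 ≤ 0 := by
    linarith
  have hM2 : M ^ 2 * Real.exp (Real.pi - 2 * (r * T)) = 1 := by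
    rw [hM, ← Real.exp_nat_mul, ← Real.exp_add, Real.exp_eq_one_iff]
    push_cast
    linear_combination -4 * hra
  have hfin : M ^ 2 * h T ≤ h 0 := by
    have : r / 2 * (M ^ 2 * h T - h 0) ≤ 0 := by
      refine le_of_eq_of_le ?_ hsum
      field_simp
      ring
    by_contra! hlt
    exact absurd this (by have := mul_pos (half_pos hr) (sub_pos.2 hlt); linarith)
  calc h T = Real.exp (Real.pi - 2 * (r * T)) * (M ^ 2 * h T) := by
        linear_combination (-h T) * hM2
    _ ≤ _ := by gcongr

/-- Wei's theorem: a contraction semigroup with resolvent bound `R(0, r)` satisfies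
`‖S(t)‖ ≤ e^{π/2 - r t}`. -/
theorem statement2 {H : Type*} [NormedAddCommGroup H] [InnerProductSpace ℂ H] [CompleteSpace H]
    (S : ℝ → H →L[ℂ] H) (D : Submodule ℂ H) (A : D →ₗ[ℂ] H)
    (hS : IsC0Semigroup S) (hA : IsGenerator S D A)
    (hcontr : ∀ t, 0 ≤ t → ‖S t‖ ≤ 1)
    (r : ℝ) (hr : 0 < r) (hres : ResolventBound D A 0 r) :
    ∀ t, 0 ≤ t → ‖S t‖ ≤ Real.exp (Real.pi / 2 - r * t) := by
  intro t ht
  rcases le_total (r * t) (Real.pi / 2) with hrt | hrt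
  · exact (hcontr t ht).trans (Real.one_le_exp (by linarith))
  have hD : ∀ x ∈ (D : Set H), ‖S t x‖ ≤ Real.exp (Real.pi / 2 - r * t) * ‖x‖ := by
    intro x hx
    have hanti : AntitoneOn (fun s => ‖S s x‖ ^ 2) (Ici 0) := by
      intro s hs u _ hsu
      have hsem : S u x = S (u - s) (S s x) := by
        rw [← ContinuousLinearMap.comp_apply, ← hS.map_add _ (sub_nonneg.2 hsu) _ hs,
          sub_add_cancel]
      have : ‖S u x‖ ≤ ‖S s x‖ := by
        rw [hsem]
        exact (S (u - s)).le_of_opNorm_le (hcontr _ (sub_nonneg.2 hsu)) _ |>.trans_eq (one_mul _)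
      exact pow_le_pow_left₀ (norm_nonneg _) this 2
    have h := hanti.le_exp_of_cutoff ((hS.cont x).norm.pow 2) hr hrt
      fun χ χ' P hχ hχ' hP h0 h1 => integral_cutoff_le hS hA hr hres hχ hχ' hP h0 h1 ⟨x, hx⟩
    rw [hS.map_zero] at h
    rw [← pow_le_pow_iff_left₀ (norm_nonneg _) (by positivity) two_ne_zero]
    rw [mul_pow, ← Real.exp_nat_mul]
    refine h.trans_eq ?_
    rw [one_apply_eq_self]
    congr 2
    push_cast
    ring
  refine (S t).opNorm_le_bound (Real.exp_pos _).le fun x => ?_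
  exact hA.dense.induction (P := fun x => ‖S t x‖ ≤ Real.exp (Real.pi / 2 - r * t) * ‖x‖) hD
    (isClosed_le (by fun_prop) (by fun_prop)) x
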